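/- Let p ≥ 2 be a prime and r = p^n with n ≥ 2. Then dim_{F_p} X_{r−1} = p + 3; indeed the set {X^r, X^{r−1}Y, Y^r, X(kX+Y)^{r−1} : k ∈ F_p} is an F_p-basis of X_{r−1}. -/

import Mathlib

open MvPolynomial

/-- The action of a 2×2 matrix `g` over `F_p` on polynomials in two variables:
`((a b; c d) · F)(X, Y) = F (aX + cY, bX + dY)`. -/
noncomputable def matAct (p : ℕ) (g : Matrix (Fin 2) (Fin 2) (ZMod p)) :
    MvPolynomial (Fin 2) (ZMod p) →ₐ[ZMod p] MvPolynomial (Fin 2) (ZMod p) :=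
  aeval fun i => ∑ j, C (g j i) * X j

/-- The action of `g` twisted by the `n`-th power of the determinant character `D`. -/
noncomputable def twAct (p n : ℕ) (g : Matrix (Fin 2) (Fin 2) (ZMod p))
    (F : MvPolynomial (Fin 2) (ZMod p)) : MvPolynomial (Fin 2) (ZMod p) :=
  g.det ^ n • matAct p g F

/-- `V_m`: homogeneous polynomials of degree `m` in two variables over `F_p`. -/
noncomputable def Vh (p m : ℕ) : Submodule (ZMod p) (MvPolynomial (Fin 2) (ZMod p)) :=
  homogeneousSubmodule (Fin 2) (ZMod p) m

/-- `X_r`: the `M`-submodule of `V_r` generated by `X^r`, realized as the span of the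
orbit of `X^r` under the monoid `M = M_2(F_p)`. -/
noncomputable def XrSub (p r : ℕ) : Submodule (ZMod p) (MvPolynomial (Fin 2) (ZMod p)) :=
  Submodule.span (ZMod p)
    (Set.range fun g : Matrix (Fin 2) (Fin 2) (ZMod p) => matAct p g (X 0 ^ r))

/-- `X_{r-1}`: the `M`-submodule of `V_r` generated by `X^{r-1} Y`. -/
noncomputable def Xr1Sub (p r : ℕ) : Submodule (ZMod p) (MvPolynomial (Fin 2) (ZMod p)) :=
  Submodule.span (ZMod p)
    (Set.range fun g : Matrix (Fin 2) (Fin 2) (ZMod p) => matAct p g (X 0 ^ (r - 1) * X 1))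

/-- The special polynomial `θ = X^p Y − X Y^p`. -/
noncomputable def theta (p : ℕ) : MvPolynomial (Fin 2) (ZMod p) :=
  X 0 ^ p * X 1 - X 0 * X 1 ^ p

/-- `V_r^* = {F ∈ V_r : θ ∣ F}`. -/
noncomputable def Vstar (p r : ℕ) : Submodule (ZMod p) (MvPolynomial (Fin 2) (ZMod p)) :=
  Vh p r ⊓ (Ideal.span {theta p}).restrictScalars (ZMod p)

/-- `V_r^{**} = {F ∈ V_r : θ² ∣ F}`. -/
noncomputable def Vdstar (p r : ℕ) : Submodule (ZMod p) (MvPolynomial (Fin 2) (ZMod p)) :=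
  Vh p r ⊓ (Ideal.span {theta p ^ 2}).restrictScalars (ZMod p)

/-- `M`-equivariance of a linear map between two submodules of the polynomial ring,
where the source carries the action twisted by `D^{nA}` and the target by `D^{nB}`. -/
def EquivMap (p nA nB : ℕ)
    {A B : Submodule (ZMod p) (MvPolynomial (Fin 2) (ZMod p))}
    (φ : A →ₗ[ZMod p] B) : Prop :=
  ∀ (g : Matrix (Fin 2) (Fin 2) (ZMod p)) (x y : A),
    (y : MvPolynomial (Fin 2) (ZMod p)) = twAct p nA g (x : MvPolynomial (Fin 2) (ZMod p)) →
    (φ y : MvPolynomial (Fin 2) (ZMod p)) = twAct p nB g (φ x : MvPolynomial (Fin 2) (ZMod p))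

/-- Modulo `p`, the binomial coefficients of `p ^ n - 1` alternate between `1` and `-1`. -/
theorem natCast_choose_prime_pow_sub_one {p n i : ℕ} [Fact p.Prime] (hi : i < p ^ n) :
    ((p ^ n - 1).choose i : ZMod p) = (-1) ^ i := by
  induction i with
  | zero => simp
  | succ i ih =>
    have hdvd : ((p ^ n).choose (i + 1) : ZMod p) = 0 :=
      (ZMod.natCast_eq_zero_iff _ _).2
        ((Fact.out : p.Prime).dvd_choose_pow (Nat.succ_ne_zero i) hi.ne)
    have hpascal := Nat.choose_succ_succ (p ^ n - 1) i
    rw [Nat.succ_eq_add_one, Nat.sub_add_cancel (by lia), Nat.succ_eq_add_one] at hpascal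
    rw [hpascal, Nat.cast_add, ih (by lia)] at hdvd
    rw [pow_succ]
    linear_combination hdvd

/-- A function on `ZMod p` whose first `p` power moments vanish is zero. -/
theorem ZMod.eq_zero_of_forall_sum_mul_pow_eq_zero {p : ℕ} [Fact p.Prime] {d : ZMod p → ZMod p}
    (hd : ∀ i < p, ∑ k, d k * k ^ i = 0) : d = 0 := by
  let e : ZMod p ≃ Fin p := Fintype.equivFinOfCardEq (ZMod.card p)
  have hv : d ∘ e.symm = 0 :=
    Matrix.eq_zero_of_forall_pow_sum_mul_pow_eq_zero e.symm.injective fun i => by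
      rw [← hd i i.2]
      exact Equiv.sum_comp e.symm fun k => d k * k ^ (i : ℕ)
  funext k
  simpa using congrFun hv (e k)

theorem ZMod.pow_prime_pow_sub_one_eq_one {p : ℕ} [Fact p.Prime] (n : ℕ) {c : ZMod p}
    (hc : c ≠ 0) : c ^ (p ^ n - 1) = 1 := by
  have h := ZMod.pow_card_pow (n := n) c
  rw [← Nat.sub_add_cancel (Nat.pow_pos (n := n) (Fact.out : p.Prime).pos), pow_succ] at h
  exact mul_right_cancel₀ hc (h.trans (one_mul c).symm)

/-- The `i`-th coefficient of `(k T + 1) ^ m`. -/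
theorem Polynomial.coeff_C_mul_X_add_one_pow {R : Type*} [CommSemiring R] (k : R) (m i : ℕ) :
    ((Polynomial.C k * Polynomial.X + 1 : Polynomial R) ^ m).coeff i = m.choose i * k ^ i := by
  have h : (Polynomial.C k * Polynomial.X + 1 : Polynomial R) ^ m =
      ((Polynomial.X + 1) ^ m).comp (Polynomial.C k * Polynomial.X) := by simp
  rw [h, Polynomial.comp_C_mul_X_coeff, Polynomial.coeff_X_add_one_pow]

/-- The generators `X^r, X^{r-1} Y, Y^r, X (k X + Y)^{r-1}` of `X_{r-1}`. -/
noncomputable def Xr1Gen (p r : ℕ) (i : Fin 3 ⊕ ZMod p) : MvPolynomial (Fin 2) (ZMod p) :=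
  Sum.elim
    (![(X 0 ^ r : MvPolynomial (Fin 2) (ZMod p)), X 0 ^ (r - 1) * X 1, X 1 ^ r])
    (fun k : ZMod p => X 0 * (C k * X 0 + X 1) ^ (r - 1)) i

theorem matAct_X (p : ℕ) (g : Matrix (Fin 2) (Fin 2) (ZMod p)) (i : Fin 2) :
    matAct p g (X i) = C (g 0 i) * X 0 + C (g 1 i) * X 1 := by
  simp [matAct, Fin.sum_univ_two]

theorem linearIndependent_Xr1Gen {p n : ℕ} [Fact p.Prime] (hn : 2 ≤ n) :
    LinearIndependent (ZMod p) (Xr1Gen p (p ^ n)) := by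
  have hp2 := (Fact.out : p.Prime).two_le
  have hlt : p + 2 ≤ p ^ n := by
    have := Nat.pow_le_pow_right (by lia : 0 < p) hn
    nlinarith
  rw [Fintype.linearIndependent_iff]
  intro g hg
  have hdehom := congrArg (aeval (R := ZMod p) ![(Polynomial.X : Polynomial (ZMod p)), 1]) hg
  simp only [Xr1Gen, Fintype.sum_sum_type, Fin.sum_univ_three, Sum.elim_inl, Sum.elim_inr,
    Matrix.cons_val_zero, Matrix.cons_val_one, Matrix.cons_val, map_add, map_sum, map_smul,
    map_mul, map_pow, aeval_X, map_zero, one_pow, mul_one, algHom_C,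
    Polynomial.algebraMap_eq] at hdehom
  have hcoeff (i : ℕ) := congrArg (fun f => Polynomial.coeff f i) hdehom
  simp only [Polynomial.coeff_add, Polynomial.finsetSum_coeff, Polynomial.coeff_smul,
    Polynomial.coeff_X_pow, Polynomial.coeff_one, Polynomial.coeff_zero, smul_eq_mul] at hcoeff
  have hinr : (fun k => g (Sum.inr k)) = 0 := by
    refine ZMod.eq_zero_of_forall_sum_mul_pow_eq_zero fun i hi => ?_
    have h := hcoeff (i + 1)
    simp only [Polynomial.coeff_X_mul, Polynomial.coeff_C_mul_X_add_one_pow,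
      natCast_choose_prime_pow_sub_one (show i < p ^ n by lia),
      if_neg (show ¬ i + 1 = p ^ n by lia), if_neg (show ¬ i + 1 = p ^ n - 1 by lia),
      if_neg (Nat.succ_ne_zero i), mul_zero, zero_add] at h
    refine (mul_eq_zero.1 (?_ : (-1) ^ i * _ = (0 : ZMod p))).resolve_left
      (pow_ne_zero _ (neg_ne_zero.2 one_ne_zero))
    rw [← h, Finset.mul_sum]
    exact Finset.sum_congr rfl fun k _ => by ring
  have hinr' (k : ZMod p) : g (Sum.inr k) = 0 := congrFun hinr k
  simp only [hinr', zero_mul, Finset.sum_const_zero, add_zero] at hcoeff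
  rintro (i | k)
  · fin_cases i
    · simpa [show p ^ n ≠ p ^ n - 1 by lia, show p ≠ 0 by lia] using hcoeff (p ^ n)
    · simpa [show p ^ n - 1 ≠ p ^ n by lia, show p ^ n - 1 ≠ 0 by lia] using hcoeff (p ^ n - 1)
    · simpa [show 0 ≠ p ^ n by lia, show 0 ≠ p ^ n - 1 by lia] using hcoeff 0
  · exact hinr' k

theorem matAct_mem_span_Xr1Gen {p n : ℕ} [Fact p.Prime] (hn : n ≠ 0)
    (g : Matrix (Fin 2) (Fin 2) (ZMod p)) :
    matAct p g (X 0 ^ (p ^ n - 1) * X 1) ∈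
      Submodule.span (ZMod p) (Set.range (Xr1Gen p (p ^ n))) := by
  have hr : p ^ n - 1 + 1 = p ^ n :=
    Nat.sub_add_cancel (Nat.pow_pos (Fact.out : p.Prime).pos)
  have hr1 : p ^ n - 1 ≠ 0 := by
    have := Nat.one_lt_pow hn (Fact.out : p.Prime).one_lt
    lia
  have hgen (i) : Xr1Gen p (p ^ n) i ∈
      Submodule.span (ZMod p) (Set.range (Xr1Gen p (p ^ n))) :=
    Submodule.subset_span ⟨i, rfl⟩
  have hX := hgen (Sum.inl 0)
  have hXY := hgen (Sum.inl 1)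
  have hY := hgen (Sum.inl 2)
  have hk (k : ZMod p) := hgen (Sum.inr k)
  generalize Submodule.span (ZMod p) (Set.range (Xr1Gen p (p ^ n))) = S at hX hXY hY hk ⊢
  simp only [Xr1Gen, Sum.elim_inl, Sum.elim_inr, Matrix.cons_val_zero, Matrix.cons_val_one,
    Matrix.cons_val] at hX hXY hY hk
  rw [map_mul, map_pow, matAct_X, matAct_X]
  generalize g 0 0 = a, g 1 0 = c, g 0 1 = b, g 1 1 = d
  by_cases hc : c = 0
  · have h := S.add_mem (S.smul_mem (a ^ (p ^ n - 1) * b) hX)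
      (S.smul_mem (a ^ (p ^ n - 1) * d) hXY)
    convert h using 1
    simp only [hc, C_0, zero_mul, add_zero, smul_eq_C_mul, C_mul, C_pow, mul_pow]
    rw [← hr, Nat.add_sub_cancel, pow_succ]
    ring
  · obtain ⟨k, rfl⟩ : ∃ k, a = c * k := ⟨c⁻¹ * a, (mul_inv_cancel_left₀ hc a).symm⟩
    have hsub : (C (c * k) * X 0 + C c * X 1 : MvPolynomial (Fin 2) (ZMod p)) ^ (p ^ n - 1) =
        (C k * X 0 + X 1) ^ (p ^ n - 1) := by
      rw [C_mul, mul_assoc, ← mul_add, mul_pow, ← C_pow, ZMod.pow_prime_pow_sub_one_eq_one n hc,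
        C_1, one_mul]
    have hfrob : (C k * X 0 + X 1 : MvPolynomial (Fin 2) (ZMod p)) ^ (p ^ n - 1) *
        (C k * X 0 + X 1) = C k * X 0 ^ p ^ n + X 1 ^ p ^ n := by
      rw [← pow_succ, hr, add_pow_char_pow, mul_pow, ← C_pow, ZMod.pow_card_pow]
    have h := S.add_mem (S.add_mem (S.smul_mem (d * k) hX) (S.smul_mem d hY))
      (S.smul_mem (b - d * k) (hk k))
    convert h using 1
    rw [hsub]
    simp only [smul_eq_C_mul, C_mul, C_sub]
    linear_combination C d * hfrob

theorem Xr1Gen_mem_Xr1Sub {p r : ℕ} (hr : r ≠ 0) (i : Fin 3 ⊕ ZMod p) :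
    Xr1Gen p r i ∈ Xr1Sub p r := by
  have hr' : r - 1 + 1 = r := by lia
  suffices ∃ g, matAct p g (X 0 ^ (r - 1) * X 1) = Xr1Gen p r i from
    Submodule.subset_span this
  simp only [map_mul, map_pow, matAct_X]
  rcases i with i | k
  · fin_cases i
    · exact ⟨!![1, 1; 0, 0], by simp [Xr1Gen, ← pow_succ, hr']⟩
    · exact ⟨!![1, 0; 0, 1], by simp [Xr1Gen]⟩
    · exact ⟨!![0, 0; 1, 1], by simp [Xr1Gen, ← pow_succ, hr']⟩
  · exact ⟨!![k, 1; 1, 0], by simp [Xr1Gen, mul_comm]⟩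

theorem span_Xr1Gen {p n : ℕ} [Fact p.Prime] (hn : n ≠ 0) :
    Submodule.span (ZMod p) (Set.range (Xr1Gen p (p ^ n))) = Xr1Sub p (p ^ n) := by
  apply le_antisymm
  · rw [Submodule.span_le]
    rintro _ ⟨i, rfl⟩
    exact Xr1Gen_mem_Xr1Sub (pow_ne_zero _ (Fact.out : p.Prime).ne_zero) i
  · rw [Xr1Sub, Submodule.span_le]
    rintro _ ⟨g, rfl⟩
    exact matAct_mem_span_Xr1Gen hn g

/-- For a prime `p` and `r = p^n` with `n ≥ 2`, one has
`dim X_{r−1} = p+3`; indeed `{X^r, X^{r−1}Y, Y^r, X(kX+Y)^{r−1} : k ∈ F_p}` is a basis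
of `X_{r−1}`. -/
theorem dim_Xr1_ppower (p r n : ℕ) (hp : p.Prime) (hn : 2 ≤ n) (hr : r = p ^ n) :
    Module.finrank (ZMod p) ↥(Xr1Sub p r) = p + 3 ∧
    LinearIndependent (ZMod p)
      (fun i : Fin 3 ⊕ ZMod p =>
        Sum.elim
          (![(X 0 ^ r : MvPolynomial (Fin 2) (ZMod p)), X 0 ^ (r - 1) * X 1, X 1 ^ r])
          (fun k : ZMod p => X 0 * (C k * X 0 + X 1) ^ (r - 1)) i) ∧
    Submodule.span (ZMod p)
      (Set.range (fun i : Fin 3 ⊕ ZMod p =>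
        Sum.elim
          (![(X 0 ^ r : MvPolynomial (Fin 2) (ZMod p)), X 0 ^ (r - 1) * X 1, X 1 ^ r])
          (fun k : ZMod p => X 0 * (C k * X 0 + X 1) ^ (r - 1)) i)) = Xr1Sub p r := by
  subst hr
  have : Fact p.Prime := ⟨hp⟩
  have hspan := span_Xr1Gen (p := p) (n := n) (by lia)
  have hli := linearIndependent_Xr1Gen (p := p) hn
  refine ⟨?_, hli, hspan⟩
  rw [← hspan, finrank_span_eq_card hli, Fintype.card_sum, Fintype.card_fin, ZMod.card, add_comm]
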